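/- Let n ≥ 1, B > -(n-2)²/4, 0 ≤ A < n−1+2ρ with ρ = ((2-n)+√((n-2)²+4B))/2, α = (n+A−1+2ρ)/2, γ = n−1+2ρ, and fix λ > 1, p > (n+ρ)/(n+ρ−1) and β < γ − α, with p' = p/(p−1). Define the test functions Ψ_β(t,x;λ) = |x|^ρ (t+|x|+λ)^{−β} F(α,β,γ; 2|x|/(t+|x|+λ)) on ℝⁿ, where F is the hypergeometric function given by the Euler integral representation, and define S(T;β₁,β) = T^{−2} ( ∫_{T/2}^T ∫_{B(0,1+t)} Ψ_{β₁}^{p'} Ψ_β^{−p'/p} dx dt )^{1/p'} + T^{−1} ( ∫_{T/2}^T ∫_{B(0,1+t)} |x|^{−p'} Ψ_{β₁}^{p'} Ψ_β^{−p'/p} dx dt )^{1/p'} + T^{−1} ( ∫_{T/2}^T ∫_{B(0,1+t)} |∂_t Ψ_{β₁}|^{p'} Ψ_β^{−p'/p} dx dt )^{1/p'}, where B(0,R) is the ball of radius R in ℝⁿ. Then there is a constant C (independent of T) such that S(T;0,β) ≤ C T^{(ρ+n+1)/p' − 2 + β/p} for all T ≥ 1. -/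

import Mathlib

open MeasureTheory

/-- The hypergeometric function via the Euler integral representation,
`F(α,β,γ;z) = (Γ(γ)/(Γ(α)Γ(γ−α))) ∫₀¹ s^(α−1) (1−s)^(γ−α−1) (1−zs)^(−β) ds`,
valid for `γ > α > 0` and `z < 1`. -/
noncomputable def hyperF (α β γ z : ℝ) : ℝ :=
  (Real.Gamma γ / (Real.Gamma α * Real.Gamma (γ - α))) *
    ∫ s in (0 : ℝ)..1, s ^ (α - 1) * (1 - s) ^ (γ - α - 1) * (1 - z * s) ^ (-β)

/-- The test function `Ψ_β(t,x;λ) = |x|^ρ (t+|x|+λ)^(−β) F(α,β,γ; 2|x|/(t+|x|+λ))`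
on `ℝⁿ`. -/
noncomputable def Psi (n : ℕ) (α γ ρ β lam : ℝ) (t : ℝ)
    (x : EuclideanSpace ℝ (Fin n)) : ℝ :=
  ‖x‖ ^ ρ * (t + ‖x‖ + lam) ^ (-β) * hyperF α β γ (2 * ‖x‖ / (t + ‖x‖ + lam))

/-- The quantity `S(T;β₁,β)` built from the three space-time integrals of the
test functions over `[T/2,T] × B(0,1+t)`. -/
noncomputable def Sfun (n : ℕ) (α γ ρ lam p p' β₁ β T : ℝ) : ℝ :=
  T ^ (-2 : ℝ) *
      (∫ t in (T/2)..T, ∫ x in Metric.ball (0 : EuclideanSpace ℝ (Fin n)) (1 + t),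
          Psi n α γ ρ β₁ lam t x ^ p' * Psi n α γ ρ β lam t x ^ (-(p' / p))) ^ (1 / p')
    + T ^ (-1 : ℝ) *
      (∫ t in (T/2)..T, ∫ x in Metric.ball (0 : EuclideanSpace ℝ (Fin n)) (1 + t),
          ‖x‖ ^ (-p') * Psi n α γ ρ β₁ lam t x ^ p' *
            Psi n α γ ρ β lam t x ^ (-(p' / p))) ^ (1 / p')
    + T ^ (-1 : ℝ) *
      (∫ t in (T/2)..T, ∫ x in Metric.ball (0 : EuclideanSpace ℝ (Fin n)) (1 + t),
          |deriv (fun t' => Psi n α γ ρ β₁ lam t' x) t| ^ p' *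
            Psi n α γ ρ β lam t x ^ (-(p' / p))) ^ (1 / p')

open Set

theorem intervalIntegrable_rpow_mul_one_sub_rpow_left {u : ℝ} (hu : 0 < u) (v : ℝ) :
    IntervalIntegrable (fun s : ℝ => s ^ (u - 1) * (1 - s) ^ (v - 1)) volume 0 (1 / 2) := by
  apply IntervalIntegrable.mul_continuousOn
  · exact intervalIntegral.intervalIntegrable_rpow' (by linarith)
  · intro x hx
    rw [uIcc_of_le (by positivity : (0 : ℝ) ≤ 1 / 2)] at hx
    exact ((continuousAt_const.sub continuousAt_id).rpow_const
      (Or.inl (by have := hx.2; change (1 : ℝ) - x ≠ 0; linarith))).continuousWithinAt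

theorem intervalIntegrable_rpow_mul_one_sub_rpow {u v : ℝ} (hu : 0 < u) (hv : 0 < v) :
    IntervalIntegrable (fun s : ℝ => s ^ (u - 1) * (1 - s) ^ (v - 1)) volume 0 1 := by
  refine (intervalIntegrable_rpow_mul_one_sub_rpow_left hu v).trans ?_
  rw [IntervalIntegrable.iff_comp_neg]
  convert! ((intervalIntegrable_rpow_mul_one_sub_rpow_left hv u).comp_add_right 1).symm using 1
  · ext1 x
    conv_lhs => rw [mul_comm]
    congr 2 <;> ring
  · norm_num
  · simp

theorem exists_pos_le_hyperF {α γ : ℝ} (hα : 0 < α) (hγ : α < γ) (β : ℝ) :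
    ∃ c : ℝ, 0 < c ∧ ∀ z : ℝ, 0 ≤ z → z < 1 → c ≤ hyperF α β γ z := by
  have hconst : 0 < Real.Gamma γ / (Real.Gamma α * Real.Gamma (γ - α)) :=
    div_pos (Real.Gamma_pos_of_pos (hα.trans hγ))
      (mul_pos (Real.Gamma_pos_of_pos hα) (Real.Gamma_pos_of_pos (sub_pos.2 hγ)))
  have hbeta := intervalIntegrable_rpow_mul_one_sub_rpow hα (sub_pos.2 hγ)
  have hlow : IntervalIntegrable
      (fun s : ℝ => s ^ (α - 1) * (1 - s) ^ (γ - α - 1) * (1 - s) ^ max (-β) 0) volume 0 1 := by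
    refine hbeta.mul_continuousOn (Continuous.continuousOn ?_)
    exact (continuous_const.sub continuous_id).rpow_const fun _ => Or.inr (le_max_right _ _)
  have hpos : 0 < ∫ s in (0 : ℝ)..1,
      s ^ (α - 1) * (1 - s) ^ (γ - α - 1) * (1 - s) ^ max (-β) 0 := by
    refine intervalIntegral.intervalIntegral_pos_of_pos_on hlow (fun s hs => ?_) one_pos
    have h0 : 0 < s := hs.1
    have h1 : 0 < 1 - s := sub_pos.2 hs.2
    positivity
  refine ⟨_, mul_pos hconst hpos, fun z hz0 hz1 => ?_⟩
  unfold hyperF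
  refine mul_le_mul_of_nonneg_left ?_ hconst.le
  have hpos_sub : ∀ s ∈ Icc (0 : ℝ) 1, 0 < 1 - z * s := fun s hs => by nlinarith [hs.1, hs.2]
  refine intervalIntegral.integral_mono_on zero_le_one hlow (hbeta.mul_continuousOn ?_) ?_
  · intro s hs
    rw [uIcc_of_le zero_le_one] at hs
    exact ((continuousAt_const.sub (continuousAt_const.mul continuousAt_id)).rpow_const
      (Or.inl (hpos_sub s hs).ne')).continuousWithinAt
  · intro s hs
    have h1 : 0 ≤ 1 - s := sub_nonneg.2 hs.2
    have h0 : 0 ≤ s := hs.1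
    refine mul_le_mul_of_nonneg_left ?_ (by positivity)
    rcases le_total (-β) 0 with hb | hb
    · rw [max_eq_right hb, Real.rpow_zero]
      exact Real.one_le_rpow_of_pos_of_le_one_of_nonpos (hpos_sub s hs) (by nlinarith) hb
    · rw [max_eq_left hb]
      exact Real.rpow_le_rpow h1 (by nlinarith) hb

theorem pow_sub_one_mul_rpow {d : ℕ} (hd : 1 ≤ d) {σ y : ℝ} (hy : 0 < y) :
    y ^ (d - 1) * y ^ σ = y ^ ((d : ℝ) + σ - 1) := by
  rw [← Real.rpow_natCast, ← Real.rpow_add hy, Nat.cast_sub hd]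
  congr 1
  push_cast
  ring

section NormPow

variable {E : Type*} [NormedAddCommGroup E] [NormedSpace ℝ E] [FiniteDimensional ℝ E]
  [Nontrivial E] [MeasurableSpace E] [BorelSpace E] (μ : Measure E) [μ.IsAddHaarMeasure]

theorem integrableOn_ball_norm_rpow {σ : ℝ} (hσ : -(Module.finrank ℝ E : ℝ) < σ) (R : ℝ) :
    IntegrableOn (fun x : E => ‖x‖ ^ σ) (Metric.ball 0 R) μ := by
  rw [integrableOn_fun_norm_addHaar μ (f := fun y : ℝ => y ^ σ)]
  have h : IntegrableOn (fun y : ℝ => y ^ ((Module.finrank ℝ E : ℝ) + σ - 1)) (Ioo 0 R) := by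
    rcases le_or_gt R 0 with hR | hR
    · simp [Ioo_eq_empty_of_le hR]
    · rw [intervalIntegral.integrableOn_Ioo_rpow_iff hR]
      linarith
  refine h.congr_fun (fun y hy => ?_) measurableSet_Ioo
  exact (pow_sub_one_mul_rpow Module.finrank_pos hy.1).symm

theorem setIntegral_ball_norm_rpow {σ R : ℝ} (hσ : -(Module.finrank ℝ E : ℝ) < σ) (hR : 0 < R) :
    ∫ x in Metric.ball (0 : E) R, ‖x‖ ^ σ ∂μ =
      Module.finrank ℝ E * μ.real (Metric.ball 0 1) / (Module.finrank ℝ E + σ) *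
        R ^ ((Module.finrank ℝ E : ℝ) + σ) := by
  have h1 : ∫ x in Metric.ball (0 : E) R, ‖x‖ ^ σ ∂μ =
      ∫ x : E, (Iio R).indicator (fun y : ℝ => y ^ σ) ‖x‖ ∂μ := by
    rw [← integral_indicator measurableSet_ball]
    congr 1 with x
    by_cases hx : ‖x‖ < R
    · rw [indicator_of_mem (mem_ball_zero_iff.2 hx), indicator_of_mem (mem_Iio.2 hx)]
    · rw [indicator_of_notMem (mt mem_ball_zero_iff.1 hx), indicator_of_notMem (mt mem_Iio.1 hx)]
  have h2 : ∫ y in Ioi (0 : ℝ), y ^ (Module.finrank ℝ E - 1) •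
      (Iio R).indicator (fun y : ℝ => y ^ σ) y = R ^ ((Module.finrank ℝ E : ℝ) + σ) /
        (Module.finrank ℝ E + σ) := by
    calc _ = ∫ y in Ioi (0 : ℝ), (Iio R).indicator
          (fun y => y ^ ((Module.finrank ℝ E : ℝ) + σ - 1)) y := by
            refine setIntegral_congr_fun measurableSet_Ioi fun y hy => ?_
            by_cases hyR : y < R
            · simp [hyR, pow_sub_one_mul_rpow Module.finrank_pos hy]
            · simp [hyR]
      _ = ∫ y in (0 : ℝ)..R, y ^ ((Module.finrank ℝ E : ℝ) + σ - 1) := by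
            rw [setIntegral_indicator measurableSet_Iio, Ioi_inter_Iio,
              intervalIntegral.integral_of_le hR.le, integral_Ioc_eq_integral_Ioo]
      _ = _ := by
            rw [integral_rpow (Or.inl (by linarith)), sub_add_cancel,
              Real.zero_rpow (by linarith), sub_zero]
  rw [h1, integral_fun_norm_addHaar μ, h2]
  simp only [nsmul_eq_mul, smul_eq_mul]
  ring

theorem exists_integral_cone_le {σ : ℝ} (hσ : -(Module.finrank ℝ E : ℝ) < σ) :
    ∃ K : ℝ, 0 ≤ K ∧ ∀ (f : ℝ → E → ℝ) (M T : ℝ), 0 ≤ M → 1 ≤ T →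
      (∀ t, T / 2 ≤ t → t ≤ T → ∀ x ∈ Metric.ball (0 : E) (1 + t), x ≠ 0 →
        0 ≤ f t x ∧ f t x ≤ M * ‖x‖ ^ σ) →
      0 ≤ ∫ t in (T / 2)..T, ∫ x in Metric.ball (0 : E) (1 + t), f t x ∂μ ∧
      ∫ t in (T / 2)..T, ∫ x in Metric.ball (0 : E) (1 + t), f t x ∂μ ≤
        K * M * T ^ ((Module.finrank ℝ E : ℝ) + σ + 1) := by
  set d : ℝ := (Module.finrank ℝ E : ℝ) with hd
  set V : ℝ := d * μ.real (Metric.ball (0 : E) 1) / (d + σ) with hV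
  have hdσ : 0 < d + σ := by linarith
  have hV0 : 0 ≤ V := by positivity
  refine ⟨V * 2 ^ (d + σ), by positivity, fun f M T hM hT hf => ?_⟩
  have hT0 : 0 < T := one_pos.trans_le hT
  have hae : ∀ t, T / 2 ≤ t → t ≤ T → ∀ᵐ x ∂μ.restrict (Metric.ball (0 : E) (1 + t)),
      0 ≤ f t x ∧ f t x ≤ M * ‖x‖ ^ σ := fun t ht1 ht2 => by
    filter_upwards [ae_restrict_mem measurableSet_ball,
      ae_restrict_of_ae (Measure.ae_ne μ (0 : E))] with x hx hx0
    exact hf t ht1 ht2 x hx hx0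
  have hnonneg : ∀ t, T / 2 ≤ t → t ≤ T →
      0 ≤ ∫ x in Metric.ball (0 : E) (1 + t), f t x ∂μ := fun t ht1 ht2 =>
    integral_nonneg_of_ae ((hae t ht1 ht2).mono fun x hx => hx.1)
  have hle : ∀ t, T / 2 ≤ t → t ≤ T →
      ∫ x in Metric.ball (0 : E) (1 + t), f t x ∂μ ≤ M * (V * (2 * T) ^ (d + σ)) :=
    fun t ht1 ht2 => by
    calc ∫ x in Metric.ball (0 : E) (1 + t), f t x ∂μ
        ≤ ∫ x in Metric.ball (0 : E) (1 + t), M * ‖x‖ ^ σ ∂μ :=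
          integral_mono_of_nonneg ((hae t ht1 ht2).mono fun x hx => hx.1)
            ((integrableOn_ball_norm_rpow μ hσ (1 + t)).const_mul M)
            ((hae t ht1 ht2).mono fun x hx => hx.2)
      _ = M * (V * (1 + t) ^ (d + σ)) := by
          rw [integral_const_mul, setIntegral_ball_norm_rpow μ hσ (by linarith)]
      _ ≤ M * (V * (2 * T) ^ (d + σ)) := by
          have h1 : 0 ≤ 1 + t := by linarith
          have h2 : 1 + t ≤ 2 * T := by linarith
          gcongr
  refine ⟨intervalIntegral.integral_nonneg (by linarith) fun t ht => hnonneg t ht.1 ht.2, ?_⟩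
  have hbound : ‖∫ t in (T / 2)..T, ∫ x in Metric.ball (0 : E) (1 + t), f t x ∂μ‖ ≤
      M * (V * (2 * T) ^ (d + σ)) * |T - T / 2| := by
    refine intervalIntegral.norm_integral_le_of_norm_le_const fun t ht => ?_
    rw [uIoc_of_le (by linarith)] at ht
    rw [Real.norm_of_nonneg (hnonneg t ht.1.le ht.2)]
    exact hle t ht.1.le ht.2
  have hlen : |T - T / 2| ≤ T := by
    rw [abs_of_nonneg (by linarith)]
    linarith
  calc ∫ t in (T / 2)..T, ∫ x in Metric.ball (0 : E) (1 + t), f t x ∂μ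
      ≤ M * (V * (2 * T) ^ (d + σ)) * |T - T / 2| := (le_abs_self _).trans hbound
    _ ≤ M * (V * (2 * T) ^ (d + σ)) * T := by gcongr
    _ = V * 2 ^ (d + σ) * M * T ^ (d + σ + 1) := by
        rw [Real.mul_rpow zero_le_two hT0.le, Real.rpow_add_one hT0.ne']
        ring

theorem exists_rpow_integral_cone_le {σ : ℝ} (hσ : -(Module.finrank ℝ E : ℝ) < σ) {M : ℝ}
    (hM : 0 ≤ M) (e : ℝ) {q : ℝ} (hq : 0 ≤ q) :
    ∃ K : ℝ, 0 ≤ K ∧ ∀ (f : ℝ → E → ℝ) (T : ℝ), 1 ≤ T →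
      (∀ t, T / 2 ≤ t → t ≤ T → ∀ x ∈ Metric.ball (0 : E) (1 + t), x ≠ 0 →
        0 ≤ f t x ∧ f t x ≤ M * T ^ e * ‖x‖ ^ σ) →
      (∫ t in (T / 2)..T, ∫ x in Metric.ball (0 : E) (1 + t), f t x ∂μ) ^ q ≤
        K * T ^ ((e + (Module.finrank ℝ E : ℝ) + σ + 1) * q) := by
  obtain ⟨K, hK, h⟩ := exists_integral_cone_le μ hσ
  refine ⟨(K * M) ^ q, by positivity, fun f T hT hf => ?_⟩
  have hT0 : 0 < T := one_pos.trans_le hT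
  obtain ⟨h0, h1⟩ := h f (M * T ^ e) T (by positivity) hT hf
  calc _ ≤ (K * (M * T ^ e) * T ^ ((Module.finrank ℝ E : ℝ) + σ + 1)) ^ q := by gcongr
    _ = (K * M * T ^ (e + (Module.finrank ℝ E : ℝ) + σ + 1)) ^ q := by
        rw [show e + (Module.finrank ℝ E : ℝ) + σ + 1 =
          e + ((Module.finrank ℝ E : ℝ) + σ + 1) by ring, Real.rpow_add hT0 e]
        congr 1
        ring
    _ = _ := by rw [Real.mul_rpow (by positivity) (by positivity), ← Real.rpow_mul hT0.le]

end NormPow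

theorem hyperF_zero_right (α γ z : ℝ) : hyperF α 0 γ z = hyperF α 0 γ 0 := by
  simp [hyperF]

theorem Psi_zero (n : ℕ) (α γ ρ lam t : ℝ) (x : EuclideanSpace ℝ (Fin n)) :
    Psi n α γ ρ 0 lam t x = ‖x‖ ^ ρ * hyperF α 0 γ 0 := by
  simp only [Psi, neg_zero, Real.rpow_zero, mul_one]
  rw [hyperF_zero_right]

theorem exists_Psi_rpow_neg_le (n : ℕ) {α γ : ℝ} (hα : 0 < α) (hγ : α < γ) (ρ β : ℝ) {lam : ℝ}
    (hlam : 1 < lam) {q : ℝ} (hq : 0 ≤ q) :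
    ∃ c : ℝ, 0 < c ∧ ∀ T t : ℝ, 1 ≤ T → T / 2 ≤ t → t ≤ T →
      ∀ x ∈ Metric.ball (0 : EuclideanSpace ℝ (Fin n)) (1 + t), x ≠ 0 →
        0 ≤ Psi n α γ ρ β lam t x ^ (-q) ∧
        Psi n α γ ρ β lam t x ^ (-q) ≤ c * T ^ (β * q) * ‖x‖ ^ (-(ρ * q)) := by
  obtain ⟨c, hc, hF⟩ := exists_pos_le_hyperF hα hγ β
  have hlam0 : 0 < 3 + lam := by linarith
  refine ⟨c ^ (-q) * ((1 / 2) ^ (β * q) + (3 + lam) ^ (β * q)), by positivity,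
    fun T t hT ht1 ht2 x hx hx0 => ?_⟩
  rw [mem_ball_zero_iff] at hx
  have hr : 0 < ‖x‖ := norm_pos_iff.2 hx0
  have hT0 : 0 < T := one_pos.trans_le hT
  have hX : 0 < t + ‖x‖ + lam := by linarith
  have hlow : c * ‖x‖ ^ ρ * (t + ‖x‖ + lam) ^ (-β) ≤ Psi n α γ ρ β lam t x := by
    have := hF (2 * ‖x‖ / (t + ‖x‖ + lam)) (by positivity)
      (by rw [div_lt_one hX]; linarith)
    calc c * ‖x‖ ^ ρ * (t + ‖x‖ + lam) ^ (-β) = ‖x‖ ^ ρ * (t + ‖x‖ + lam) ^ (-β) * c := by ring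
      _ ≤ _ := mul_le_mul_of_nonneg_left this (by positivity)
  have hlow0 : 0 < c * ‖x‖ ^ ρ * (t + ‖x‖ + lam) ^ (-β) := by positivity
  refine ⟨Real.rpow_nonneg (hlow0.le.trans hlow) _, ?_⟩
  have hpow : (t + ‖x‖ + lam) ^ (β * q) ≤
      ((1 / 2) ^ (β * q) + (3 + lam) ^ (β * q)) * T ^ (β * q) := by
    rw [add_mul, ← Real.mul_rpow (by norm_num) hT0.le, ← Real.mul_rpow hlam0.le hT0.le]
    rcases le_total 0 (β * q) with h | h
    · refine (Real.rpow_le_rpow hX.le ?_ h).trans (le_add_of_nonneg_left (by positivity))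
      nlinarith
    · refine (Real.rpow_le_rpow_of_nonpos (by positivity) ?_ h).trans
        (le_add_of_nonneg_right (by positivity))
      linarith
  calc Psi n α γ ρ β lam t x ^ (-q)
      ≤ (c * ‖x‖ ^ ρ * (t + ‖x‖ + lam) ^ (-β)) ^ (-q) :=
        Real.rpow_le_rpow_of_nonpos hlow0 hlow (by linarith)
    _ = c ^ (-q) * ‖x‖ ^ (-(ρ * q)) * (t + ‖x‖ + lam) ^ (β * q) := by
        rw [Real.mul_rpow (by positivity) (by positivity), Real.mul_rpow hc.le (by positivity),
          ← Real.rpow_mul hr.le, ← Real.rpow_mul hX.le, neg_mul_neg, mul_neg]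
    _ ≤ c ^ (-q) * ‖x‖ ^ (-(ρ * q)) *
          (((1 / 2) ^ (β * q) + (3 + lam) ^ (β * q)) * T ^ (β * q)) := by gcongr
    _ = _ := by ring

/-- with `β₁ = 0`, there is a constant `C` independent of `T`
such that `S(T;0,β) ≤ C T^((ρ+n+1)/p' − 2 + β/p)` for all `T ≥ 1`. -/
theorem stmt9 (n : ℕ) (hn : 1 ≤ n) (A B : ℝ)
    (hB : -((n : ℝ) - 2) ^ 2 / 4 < B)
    (ρ : ℝ) (hρ : ρ = ((2 - (n : ℝ)) + Real.sqrt (((n : ℝ) - 2) ^ 2 + 4 * B)) / 2)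
    (hA0 : 0 ≤ A) (hA1 : A < (n : ℝ) - 1 + 2 * ρ)
    (α γ : ℝ) (hα : α = ((n : ℝ) + A - 1 + 2 * ρ) / 2) (hγ : γ = (n : ℝ) - 1 + 2 * ρ)
    (lam : ℝ) (hlam : 1 < lam)
    (p : ℝ) (hp : ((n : ℝ) + ρ) / ((n : ℝ) + ρ - 1) < p)
    (p' : ℝ) (hp' : p' = p / (p - 1))
    (β : ℝ) (hβ : β < γ - α) :
    ∃ C : ℝ, 0 < C ∧ ∀ T : ℝ, 1 ≤ T →
      Sfun n α γ ρ lam p p' 0 β T ≤ C * T ^ ((ρ + n + 1) / p' - 2 + β / p) := by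
  have hn1 : (1 : ℝ) ≤ n := by exact_mod_cast hn
  have hsqrt : 0 < Real.sqrt (((n : ℝ) - 2) ^ 2 + 4 * B) := Real.sqrt_pos.2 (by linarith)
  have hα0 : 0 < α := by linarith
  have hαγ : α < γ := by linarith
  have hnρ : 0 < (n : ℝ) + ρ - 1 := by linarith
  have hp1 : 1 < p := by
    refine lt_trans ?_ hp
    rw [one_lt_div hnρ]
    linarith
  have hp0 : 0 < p := by linarith
  have hpm : 0 < p - 1 := by linarith
  have hp'0 : 0 < p' := by rw [hp']; positivity
  have hp'n : p' < n + ρ := by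
    rw [div_lt_iff₀ hnρ] at hp
    rw [hp', div_lt_iff₀ hpm]
    linarith
  have hq : p' / p = p' - 1 := by
    rw [hp']
    field_simp
    ring
  have hpq : (p' - 1) * (1 / p') = 1 / p := by
    rw [← hq]
    field_simp
  have hq0 : 0 ≤ p' / p := by positivity
  have : Nontrivial (EuclideanSpace ℝ (Fin n)) := by
    rw [← Module.finrank_pos_iff (R := ℝ), finrank_euclideanSpace_fin]
    omega
  have hdim : (Module.finrank ℝ (EuclideanSpace ℝ (Fin n)) : ℝ) = n := by simp
  obtain ⟨c, hc, hPsi⟩ := exists_Psi_rpow_neg_le n hα0 hαγ ρ β hlam hq0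
  obtain ⟨b, hb, hF⟩ := exists_pos_le_hyperF hα0 hαγ 0
  have hF0 : 0 < hyperF α 0 γ 0 := hb.trans_le (hF 0 le_rfl one_pos)
  set F0 := hyperF α 0 γ 0
  have hM : 0 ≤ F0 ^ p' * c := by positivity
  have hinv : 0 ≤ 1 / p' := by positivity
  obtain ⟨K₁, hK₁, h₁⟩ := exists_rpow_integral_cone_le
    (volume : Measure (EuclideanSpace ℝ (Fin n))) (σ := ρ) (by rw [hdim]; linarith) hM
    (β * (p' / p)) hinv
  obtain ⟨K₂, hK₂, h₂⟩ := exists_rpow_integral_cone_le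
    (volume : Measure (EuclideanSpace ℝ (Fin n))) (σ := ρ - p') (by rw [hdim]; linarith) hM
    (β * (p' / p)) hinv
  have hmul : ∀ T t : ℝ, 1 ≤ T → T / 2 ≤ t → t ≤ T →
      ∀ x ∈ Metric.ball (0 : EuclideanSpace ℝ (Fin n)) (1 + t), x ≠ 0 →
        0 ≤ Psi n α γ ρ 0 lam t x ^ p' * Psi n α γ ρ β lam t x ^ (-(p' / p)) ∧
        Psi n α γ ρ 0 lam t x ^ p' * Psi n α γ ρ β lam t x ^ (-(p' / p)) ≤
          F0 ^ p' * c * T ^ (β * (p' / p)) * ‖x‖ ^ ρ := by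
    intro T t hT ht1 ht2 x hx hx0
    obtain ⟨g0, g1⟩ := hPsi T t hT ht1 ht2 x hx hx0
    have hr : 0 < ‖x‖ := norm_pos_iff.2 hx0
    rw [Psi_zero, Real.mul_rpow (by positivity) hF0.le, ← Real.rpow_mul hr.le]
    refine ⟨by positivity, ?_⟩
    calc _ ≤ ‖x‖ ^ (ρ * p') * F0 ^ p' *
          (c * T ^ (β * (p' / p)) * ‖x‖ ^ (-(ρ * (p' / p)))) := by gcongr
      _ = F0 ^ p' * c * T ^ (β * (p' / p)) *
          (‖x‖ ^ (ρ * p') * ‖x‖ ^ (-(ρ * (p' / p)))) := by ring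
      _ = _ := by
          rw [← Real.rpow_add hr, hq]
          ring_nf
  refine ⟨K₁ + K₂ + 1, by positivity, fun T hT => ?_⟩
  have hT0 : 0 < T := one_pos.trans_le hT
  have hderiv : ∀ (t : ℝ) (x : EuclideanSpace ℝ (Fin n)),
      deriv (fun t' => Psi n α γ ρ 0 lam t' x) t = 0 := fun t x => by
    simp only [Psi_zero, deriv_const]
  have e₁ := h₁ (fun t x => Psi n α γ ρ 0 lam t x ^ p' * Psi n α γ ρ β lam t x ^ (-(p' / p)))
    T hT (fun t ht1 ht2 x hx hx0 => hmul T t hT ht1 ht2 x hx hx0)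
  have e₂ := h₂ (fun t x => ‖x‖ ^ (-p') * Psi n α γ ρ 0 lam t x ^ p' *
    Psi n α γ ρ β lam t x ^ (-(p' / p))) T hT (fun t ht1 ht2 x hx hx0 => by
      obtain ⟨g0, g1⟩ := hmul T t hT ht1 ht2 x hx hx0
      have hr : 0 < ‖x‖ := norm_pos_iff.2 hx0
      have hr' : 0 ≤ ‖x‖ ^ (-p') := by positivity
      rw [mul_assoc]
      refine ⟨mul_nonneg hr' g0, (mul_le_mul_of_nonneg_left g1 hr').trans_eq ?_⟩
      rw [sub_eq_add_neg, Real.rpow_add hr]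
      ring)
  have hexp₁ : (β * (p' / p) + n + ρ + 1) * (1 / p') = (ρ + n + 1) / p' + β / p := by
    field_simp
    ring
  have hexp₂ : (β * (p' / p) + n + (ρ - p') + 1) * (1 / p') =
      (ρ + n + 1) / p' + β / p - 1 := by
    field_simp
    ring
  rw [hdim, hexp₁] at e₁
  rw [hdim, hexp₂] at e₂
  have t₁ : T ^ (-2 : ℝ) * (K₁ * T ^ ((ρ + n + 1) / p' + β / p)) =
      K₁ * T ^ ((ρ + n + 1) / p' - 2 + β / p) := by
    rw [mul_left_comm, ← Real.rpow_add hT0]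
    ring_nf
  have t₂ : T ^ (-1 : ℝ) * (K₂ * T ^ ((ρ + n + 1) / p' + β / p - 1)) =
      K₂ * T ^ ((ρ + n + 1) / p' - 2 + β / p) := by
    rw [mul_left_comm, ← Real.rpow_add hT0]
    ring_nf
  have f₁ := mul_le_mul_of_nonneg_left e₁ (Real.rpow_nonneg hT0.le (-2))
  have f₂ := mul_le_mul_of_nonneg_left e₂ (Real.rpow_nonneg hT0.le (-1))
  rw [t₁] at f₁
  rw [t₂] at f₂
  have hpos : 0 ≤ T ^ ((ρ + n + 1) / p' - 2 + β / p) := by positivity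
  unfold Sfun
  simp only [hderiv, abs_zero, Real.zero_rpow hp'0.ne', zero_mul, integral_zero,
    intervalIntegral.integral_zero, Real.zero_rpow (one_div_pos.2 hp'0).ne', mul_zero, add_zero]
  linarith
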